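/- arXiv:1705.04379 — 6 statements merged into one kernel-verified Lean document; each statement's English description precedes it below -/
import Mathlib

section
/- Suppose the sampling set M satisfies the network nullspace property NNSP-F relative to the partition F with constant κ=2. Then for any graph signal x observed on M, every solution x̂ of the recovery problem (minimizing ‖·‖_TV over signals agreeing with x on M) satisfies ‖x̂ − x‖_TV ≤ 6 · min over coefficient vectors a∈ℝ^{|F|} of ‖x − Σ_{C∈F} a_C 1_C‖_TV. -/
open Finset

variable {V : Type*} [DecidableEq V] {ι : Type*} [DecidableEq ι]

/-- Total variation of the graph signal `x` accumulated over the (oriented) edge set `S`,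
with weights `W`: `‖x‖_S = Σ_{e ∈ S} W_e |x[e⁺] − x[e⁻]|`. -/
noncomputable def tvOn (W : V × V → ℝ) (S : Finset (V × V)) (x : V → ℝ) : ℝ :=
  ∑ e ∈ S, W e * |x e.1 - x e.2|

/-- Boundary `∂F` of the partition encoded by the cluster map `c` (clusters are fibers of `c`):
the edges whose endpoints lie in different clusters. -/
def boundary (E : Finset (V × V)) (c : V → ι) : Finset (V × V) :=
  E.filter (fun e => c e.1 ≠ c e.2)

/-- `f` is a flow on the oriented edges `E` with demands `g`:
at every node `i`, (flow into `i` as head) − (flow out of `i` as tail) equals `g i`. -/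
def IsFlowWith (E : Finset (V × V)) (f : V × V → ℝ) (g : V → ℝ) : Prop :=
  ∀ i : V, (∑ e ∈ E.filter (fun e => e.1 = i), f e)
      - (∑ e ∈ E.filter (fun e => e.2 = i), f e) = g i

/-- The sampling set `M` satisfies the network nullspace property NNSP-F with constant `κ`:
for every signature `σ ∈ {−1,+1}^{∂F}` there is a flow `f` with demands `g` vanishing
outside `M`, with `f[e] = κ σ_e W_e` on boundary edges and `|f[e]| ≤ W_e` elsewhere. -/
def NNSP (E : Finset (V × V)) (W : V × V → ℝ) (c : V → ι) (M : Finset V) (κ : ℝ) : Prop :=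
  ∀ σ : V × V → ℝ, (∀ e ∈ boundary E c, σ e = 1 ∨ σ e = -1) →
    ∃ f : V × V → ℝ, ∃ g : V → ℝ, IsFlowWith E f g ∧
      (∀ i : V, i ∉ M → g i = 0) ∧
      (∀ e ∈ boundary E c, f e = κ * σ e * W e) ∧
      (∀ e ∈ E \ boundary E c, |f e| ≤ W e)

/-- The sampling set `M` satisfies the stable analysis nullspace property with constant `κ`
w.r.t. the edge set `S`: `‖u‖_{E∖S} ≥ κ ‖u‖_S` for every signal `u` vanishing on `M`. -/
def StableNSP (E : Finset (V × V)) (W : V × V → ℝ) (S : Finset (V × V))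
    (M : Finset V) (κ : ℝ) : Prop :=
  ∀ u : V → ℝ, (∀ i ∈ M, u i = 0) → κ * tvOn W S u ≤ tvOn W (E \ S) u

/-- Discrete integration by parts: pairing of a flow with a potential. -/
theorem flow_pairing (E : Finset (V × V)) (f : V × V → ℝ) (g : V → ℝ)
    (hf : IsFlowWith E f g) (u : V → ℝ) (hug : ∀ i, u i * g i = 0) :
    ∑ e ∈ E, f e * (u e.1 - u e.2) = 0 := by
  set T : Finset V := E.image Prod.fst ∪ E.image Prod.snd with hT
  have h1 : ∑ i ∈ T, ∑ e ∈ E.filter (fun e => e.1 = i), f e * u e.1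
      = ∑ e ∈ E, f e * u e.1 :=
    Finset.sum_fiberwise_of_maps_to
      (fun e he => Finset.mem_union_left _ (Finset.mem_image_of_mem _ he)) _
  have h2 : ∑ i ∈ T, ∑ e ∈ E.filter (fun e => e.2 = i), f e * u e.2
      = ∑ e ∈ E, f e * u e.2 :=
    Finset.sum_fiberwise_of_maps_to
      (fun e he => Finset.mem_union_right _ (Finset.mem_image_of_mem _ he)) _
  simp only [mul_sub, Finset.sum_sub_distrib]
  rw [← h1, ← h2, ← Finset.sum_sub_distrib]
  apply Finset.sum_eq_zero
  intro i _
  have e1 : ∑ e ∈ E.filter (fun e => e.1 = i), f e * u e.1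
      = (∑ e ∈ E.filter (fun e => e.1 = i), f e) * u i := by
    rw [Finset.sum_mul]
    refine Finset.sum_congr rfl fun e he => ?_
    rw [(Finset.mem_filter.mp he).2]
  have e2 : ∑ e ∈ E.filter (fun e => e.2 = i), f e * u e.2
      = (∑ e ∈ E.filter (fun e => e.2 = i), f e) * u i := by
    rw [Finset.sum_mul]
    refine Finset.sum_congr rfl fun e he => ?_
    rw [(Finset.mem_filter.mp he).2]
  rw [e1, e2, ← sub_mul, hf i, mul_comm]
  exact hug i

/-- The network nullspace property implies the stable nullspace property. -/
theorem nnsp_stableNSP (E : Finset (V × V)) (W : V × V → ℝ)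
    (c : V → ι) (M : Finset V) (κ : ℝ) (h : NNSP E W c M κ) :
    StableNSP E W (boundary E c) M κ := by
  intro u hu
  obtain ⟨f, g, hfl, hg, hb, hi⟩ := h (fun e => if 0 ≤ u e.1 - u e.2 then 1 else -1)
    (by intro e _; by_cases h0 : 0 ≤ u e.1 - u e.2 <;> simp [h0])
  have hz := flow_pairing E f g hfl u (by
    intro i
    by_cases hM : i ∈ M
    · simp [hu i hM]
    · simp [hg i hM])
  have hsub : boundary E c ⊆ E := Finset.filter_subset _ _
  rw [← Finset.sum_sdiff hsub] at hz
  have hB : ∑ e ∈ boundary E c, f e * (u e.1 - u e.2) = κ * tvOn W (boundary E c) u := by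
    unfold tvOn
    rw [Finset.mul_sum]
    refine Finset.sum_congr rfl fun e he => ?_
    rw [hb e he]
    by_cases h0 : 0 ≤ u e.1 - u e.2
    · simp only [h0, if_true, abs_of_nonneg h0]; ring
    · simp only [h0, if_false, abs_of_neg (not_le.mp h0)]; ring
  have hI : -∑ e ∈ E \ boundary E c, f e * (u e.1 - u e.2) ≤ tvOn W (E \ boundary E c) u := by
    unfold tvOn
    rw [← Finset.sum_neg_distrib]
    refine Finset.sum_le_sum fun e he => ?_
    calc -(f e * (u e.1 - u e.2)) ≤ |f e * (u e.1 - u e.2)| := neg_le_abs _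
      _ = |f e| * |u e.1 - u e.2| := abs_mul _ _
      _ ≤ W e * |u e.1 - u e.2| := mul_le_mul_of_nonneg_right (hi e he) (abs_nonneg _)
  linarith

/-- Triangle inequality for the total variation on a set of edges. -/
theorem tvOn_triangle (W : V × V → ℝ) (S : Finset (V × V)) (hW : ∀ e ∈ S, 0 ≤ W e)
    (p q r : V → ℝ) (hs : (∀ i, p i = q i + r i) ∨ (∀ i, p i = q i - r i)) :
    tvOn W S p ≤ tvOn W S q + tvOn W S r := by
  unfold tvOn
  rw [← Finset.sum_add_distrib]
  refine Finset.sum_le_sum fun e he => ?_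
  rw [← mul_add]
  refine mul_le_mul_of_nonneg_left ?_ (hW e he)
  rcases hs with hs | hs
  · rw [hs, hs, show q e.1 + r e.1 - (q e.2 + r e.2) = (q e.1 - q e.2) + (r e.1 - r e.2) by ring]
    exact abs_add_le _ _
  · rw [hs, hs, show q e.1 - r e.1 - (q e.2 - r e.2) = (q e.1 - q e.2) - (r e.1 - r e.2) by ring]
    exact abs_sub _ _

/-- If `M` satisfies NNSP-F with constant `κ = 2`, then any solution `xhat` of
the TV-minimization recovery problem for a signal `x` observed on `M` satisfies
`‖xhat − x‖_TV ≤ 6 · min_a ‖x − Σ_C a_C 1_C‖_TV` (stated as a bound for every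
coefficient vector `a`). -/
theorem nnsp_stable_recovery
    (E : Finset (V × V)) (W : V × V → ℝ) (hW : ∀ e ∈ E, 0 < W e)
    (c : V → ι) (M : Finset V)
    (hNNSP : NNSP E W c M 2) (x : V → ℝ)
    (xhat : V → ℝ) (hfeas : ∀ i ∈ M, xhat i = x i)
    (hopt : ∀ y : V → ℝ, (∀ i ∈ M, y i = x i) → tvOn W E xhat ≤ tvOn W E y) :
    ∀ a : ι → ℝ,
      tvOn W E (fun i => xhat i - x i) ≤ 6 * tvOn W E (fun i => x i - a (c i)) := by
  intro a
  have hsub : boundary E c ⊆ E := Finset.filter_subset _ _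
  have hsplit : ∀ p : V → ℝ, tvOn W E p
      = tvOn W (E \ boundary E c) p + tvOn W (boundary E c) p := fun p =>
    (Finset.sum_sdiff hsub).symm
  have hWB : ∀ e ∈ boundary E c, 0 ≤ W e := fun e he => (hW e (hsub he)).le
  have hWI : ∀ e ∈ E \ boundary E c, 0 ≤ W e := fun e he =>
    (hW e (Finset.mem_sdiff.mp he).1).le
  have hnsp := nnsp_stableNSP E W c M 2 hNNSP (fun i => xhat i - x i)
    (fun i hi => by simp [hfeas i hi])
  have ho := hopt x (fun _ _ => rfl)
  have t1 := tvOn_triangle W (boundary E c) hWB x xhat (fun i => xhat i - x i)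
    (Or.inr fun i => by ring)
  have t2 := tvOn_triangle W (E \ boundary E c) hWI (fun i => xhat i - x i) xhat x
    (Or.inr fun i => rfl)
  have hx : tvOn W (E \ boundary E c) (fun i => x i - a (c i))
      = tvOn W (E \ boundary E c) x := by
    unfold tvOn
    refine Finset.sum_congr rfl fun e he => ?_
    have hc : c e.1 = c e.2 := by
      by_contra hne
      exact (Finset.mem_sdiff.mp he).2
        (Finset.mem_filter.mpr ⟨(Finset.mem_sdiff.mp he).1, hne⟩)
    simp only [hc, sub_sub_sub_cancel_right]
  have hnn : 0 ≤ tvOn W (boundary E c) (fun i => x i - a (c i)) :=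
    Finset.sum_nonneg fun e he => mul_nonneg (hWB e he) (abs_nonneg _)
  rw [hsplit xhat, hsplit x] at ho
  rw [hsplit (fun i => xhat i - x i), hsplit (fun i => x i - a (c i)), hx]
  linarith
end

section
/- Suppose the sampling set M satisfies the stable analysis nullspace property with constant κ=2 with respect to the edge set S=∂F, i.e., ‖u‖_{E∖∂F} ≥ 2‖u‖_{∂F} for every signal u vanishing on M. Then for any graph signal x observed on M, every solution x̂ of the recovery problem (minimizing ‖·‖_TV over signals agreeing with x on M) satisfies ‖x − x̂‖_TV ≤ 6 · min over coefficients a_1,…,a_{|F|}∈ℝ of ‖x − Σ_l a_l 1_{C_l}‖_TV. -/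
open Finset

variable {V : Type*} [DecidableEq V] {ι : Type*} [DecidableEq ι]

/-- If `M` satisfies the stable analysis nullspace property with constant `κ = 2`
w.r.t. `S = ∂F`, then any solution `xhat` of the TV-minimization recovery problem for a signal
`x` observed on `M` satisfies `‖x − xhat‖_TV ≤ 6 · min_a ‖x − Σ_l a_l 1_{C_l}‖_TV`
(stated as a bound for every coefficient vector `a`). -/
theorem nsp_stable_recovery
    (E : Finset (V × V)) (W : V × V → ℝ) (hW : ∀ e ∈ E, 0 < W e)
    (c : V → ι) (M : Finset V)
    (hNSP : StableNSP E W (boundary E c) M 2) (x : V → ℝ)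
    (xhat : V → ℝ) (hfeas : ∀ i ∈ M, xhat i = x i)
    (hopt : ∀ y : V → ℝ, (∀ i ∈ M, y i = x i) → tvOn W E xhat ≤ tvOn W E y) :
    ∀ a : ι → ℝ,
      tvOn W E (fun i => x i - xhat i) ≤ 6 * tvOn W E (fun i => x i - a (c i)) := by
  intro a
  have hsub : boundary E c ⊆ E := Finset.filter_subset _ _
  have hsplit : ∀ y : V → ℝ,
      tvOn W (E \ boundary E c) y + tvOn W (boundary E c) y = tvOn W E y := fun y =>
    Finset.sum_sdiff hsub
  have h0 := hopt x (fun _ _ => rfl)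
  have h1 := hNSP (fun i => x i - xhat i) (fun i hi => by simp [hfeas i hi])
  have hS : tvOn W (boundary E c) x ≤
      tvOn W (boundary E c) xhat + tvOn W (boundary E c) (fun i => x i - xhat i) := by
    unfold tvOn
    rw [← Finset.sum_add_distrib]
    refine Finset.sum_le_sum fun e he => ?_
    rw [← mul_add]
    refine mul_le_mul_of_nonneg_left ?_ (hW e (hsub he)).le
    have h := abs_add_le (xhat e.1 - xhat e.2) ((x e.1 - xhat e.1) - (x e.2 - xhat e.2))
    have h' : xhat e.1 - xhat e.2 + ((x e.1 - xhat e.1) - (x e.2 - xhat e.2)) =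
        x e.1 - x e.2 := by ring
    rwa [h'] at h
  have hC : tvOn W (E \ boundary E c) (fun i => x i - xhat i) ≤
      tvOn W (E \ boundary E c) x + tvOn W (E \ boundary E c) xhat := by
    unfold tvOn
    rw [← Finset.sum_add_distrib]
    refine Finset.sum_le_sum fun e he => ?_
    rw [← mul_add]
    refine mul_le_mul_of_nonneg_left ?_ (hW e (Finset.mem_sdiff.1 he).1).le
    have h := abs_add_le (x e.1 - x e.2) (-(xhat e.1 - xhat e.2))
    have h' : x e.1 - x e.2 + -(xhat e.1 - xhat e.2) =
        (x e.1 - xhat e.1) - (x e.2 - xhat e.2) := by ring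
    rwa [h', abs_neg] at h
  have hx : tvOn W (E \ boundary E c) x =
      tvOn W (E \ boundary E c) (fun i => x i - a (c i)) := by
    unfold tvOn
    refine Finset.sum_congr rfl fun e he => ?_
    have hc : c e.1 = c e.2 := by
      by_contra h
      exact (Finset.mem_sdiff.1 he).2 (Finset.mem_filter.2 ⟨(Finset.mem_sdiff.1 he).1, h⟩)
    simp [hc]
  have hn : 0 ≤ tvOn W (boundary E c) (fun i => x i - a (c i)) :=
    Finset.sum_nonneg fun e he => mul_nonneg (hW e (hsub he)).le (abs_nonneg _)
  have e1 := hsplit x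
  have e2 := hsplit xhat
  have e3 := hsplit (fun i => x i - xhat i)
  have e4 := hsplit (fun i => x i - a (c i))
  linarith
end

section
/- If a sampling set M satisfies the network nullspace property NNSP-F relative to the partition F with constant κ>1, then M satisfies the stable analysis nullspace property with the same constant κ with respect to the edge set S=∂F; that is, every graph signal u vanishing on all nodes of M satisfies ‖u‖_{E∖∂F} ≥ κ‖u‖_{∂F}. -/
open Finset

variable {V : Type*} [DecidableEq V] {ι : Type*} [DecidableEq ι]

/-- NNSP-F with constant `κ > 1` implies the stable analysis nullspace property
with the same constant `κ` w.r.t. `S = ∂F`: every signal `u` vanishing on `M` satisfies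
`‖u‖_{E∖∂F} ≥ κ ‖u‖_{∂F}`. -/
theorem nnsp_implies_stable_nsp
    (E : Finset (V × V)) (W : V × V → ℝ) (hW : ∀ e ∈ E, 0 < W e)
    (c : V → ι) (M : Finset V) (κ : ℝ) (hκ : 1 < κ)
    (hNNSP : NNSP E W c M κ) :
    ∀ u : V → ℝ, (∀ i ∈ M, u i = 0) →
      κ * tvOn W (boundary E c) u ≤ tvOn W (E \ boundary E c) u := by
  intro u hu
  obtain ⟨f, g, hflow, hg, hb, hr⟩ := hNNSP (fun e => if u e.2 ≤ u e.1 then 1 else -1)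
    (by intro e _; by_cases h : u e.2 ≤ u e.1 <;> simp [h])
  have key : ∑ e ∈ E, f e * (u e.1 - u e.2) = 0 := by
    have h1 : ∑ i ∈ E.image Prod.fst ∪ E.image Prod.snd,
        ∑ e ∈ E.filter (fun e => e.1 = i), f e * u e.1 = ∑ e ∈ E, f e * u e.1 :=
      Finset.sum_fiberwise_of_maps_to
        (fun e he => Finset.mem_union_left _ (Finset.mem_image_of_mem _ he)) _
    have h2 : ∑ i ∈ E.image Prod.fst ∪ E.image Prod.snd,
        ∑ e ∈ E.filter (fun e => e.2 = i), f e * u e.2 = ∑ e ∈ E, f e * u e.2 :=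
      Finset.sum_fiberwise_of_maps_to
        (fun e he => Finset.mem_union_right _ (Finset.mem_image_of_mem _ he)) _
    simp only [mul_sub, Finset.sum_sub_distrib]
    rw [← h1, ← h2, ← Finset.sum_sub_distrib]
    refine Finset.sum_eq_zero fun i _ => ?_
    have h3 : ∑ e ∈ E.filter (fun e => e.1 = i), f e * u e.1
        = (∑ e ∈ E.filter (fun e => e.1 = i), f e) * u i := by
      rw [Finset.sum_mul]
      exact Finset.sum_congr rfl fun e he => by rw [(Finset.mem_filter.mp he).2]
    have h4 : ∑ e ∈ E.filter (fun e => e.2 = i), f e * u e.2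
        = (∑ e ∈ E.filter (fun e => e.2 = i), f e) * u i := by
      rw [Finset.sum_mul]
      exact Finset.sum_congr rfl fun e he => by rw [(Finset.mem_filter.mp he).2]
    rw [h3, h4, ← sub_mul, hflow i]
    by_cases hi : i ∈ M
    · rw [hu i hi, mul_zero]
    · rw [hg i hi, zero_mul]
  have hsub : boundary E c ⊆ E := Finset.filter_subset _ _
  rw [← Finset.sum_sdiff hsub] at key
  have hB : ∑ e ∈ boundary E c, f e * (u e.1 - u e.2) = κ * tvOn W (boundary E c) u := by
    unfold tvOn
    rw [Finset.mul_sum]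
    refine Finset.sum_congr rfl fun e he => ?_
    rw [hb e he]
    by_cases h : u e.2 ≤ u e.1
    · simp only [h, if_true]
      rw [abs_of_nonneg (sub_nonneg.mpr h)]
      ring
    · simp only [h, if_false]
      rw [abs_of_neg (by linarith [not_le.mp h])]
      ring
  have hR : -∑ e ∈ E \ boundary E c, f e * (u e.1 - u e.2) ≤ tvOn W (E \ boundary E c) u := by
    unfold tvOn
    rw [← Finset.sum_neg_distrib]
    refine Finset.sum_le_sum fun e he => ?_
    calc -(f e * (u e.1 - u e.2)) ≤ |f e * (u e.1 - u e.2)| := neg_le_abs _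
      _ = |f e| * |u e.1 - u e.2| := abs_mul _ _
      _ ≤ W e * |u e.1 - u e.2| := mul_le_mul_of_nonneg_right (hr e he) (abs_nonneg _)
  linarith
end

section
/- Let u be a graph signal vanishing on all nodes of a sampling set M, and suppose there exists a flow f with demands g such that g[i]=0 for every i∉M, f[e]=κ σ_e W_e for every boundary edge e∈∂F where σ_e∈{−1,+1} is the sign of u[e⁺]−u[e⁻] (any sign if this difference is zero), and |f[e]|≤W_e for every e∈E∖∂F. Then ‖u‖_{E∖∂F} ≥ κ‖u‖_{∂F}. -/
open Finset

variable {V : Type*} [DecidableEq V] {ι : Type*} [DecidableEq ι]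

/-- Let `u` vanish on `M` and suppose there is a flow `f` with demands `g`
vanishing outside `M`, with `f[e] = κ σ_e W_e` on every boundary edge, where `σ_e ∈ {−1,+1}`
matches the sign of `u[e⁺] − u[e⁻]` (any sign when this difference vanishes), and
`|f[e]| ≤ W_e` off the boundary. Then `‖u‖_{E∖∂F} ≥ κ ‖u‖_{∂F}`. -/
theorem flow_implies_nullspace_inequality
    (E : Finset (V × V)) (W : V × V → ℝ) (hW : ∀ e ∈ E, 0 < W e)
    (c : V → ι) (M : Finset V) (κ : ℝ) (hκ : 1 < κ)
    (u : V → ℝ) (hu : ∀ i ∈ M, u i = 0)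
    (σ : V × V → ℝ)
    (hσ : ∀ e ∈ boundary E c, (σ e = 1 ∨ σ e = -1) ∧
      σ e * (u e.1 - u e.2) = |u e.1 - u e.2|)
    (f : V × V → ℝ) (g : V → ℝ)
    (hf : IsFlowWith E f g) (hg : ∀ i : V, i ∉ M → g i = 0)
    (hbd : ∀ e ∈ boundary E c, f e = κ * σ e * W e)
    (hoff : ∀ e ∈ E \ boundary E c, |f e| ≤ W e) :
    κ * tvOn W (boundary E c) u ≤ tvOn W (E \ boundary E c) u := by
  have key : ∑ e ∈ E, f e * (u e.1 - u e.2) = 0 := by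
    set T : Finset V := E.image Prod.fst ∪ E.image Prod.snd with hT
    have h1 : ∑ i ∈ T, u i * (∑ e ∈ E.filter (fun e => e.1 = i), f e)
        = ∑ e ∈ E, f e * u e.1 := by
      rw [← Finset.sum_fiberwise_of_maps_to (s := E) (t := T) (g := fun e => e.1)
        (fun e he => Finset.mem_union_left _ (Finset.mem_image_of_mem _ he))]
      refine Finset.sum_congr rfl fun i _ => ?_
      rw [Finset.mul_sum]
      refine Finset.sum_congr rfl fun e he => ?_
      rw [(Finset.mem_filter.1 he).2, mul_comm]
    have h2 : ∑ i ∈ T, u i * (∑ e ∈ E.filter (fun e => e.2 = i), f e)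
        = ∑ e ∈ E, f e * u e.2 := by
      rw [← Finset.sum_fiberwise_of_maps_to (s := E) (t := T) (g := fun e => e.2)
        (fun e he => Finset.mem_union_right _ (Finset.mem_image_of_mem _ he))]
      refine Finset.sum_congr rfl fun i _ => ?_
      rw [Finset.mul_sum]
      refine Finset.sum_congr rfl fun e he => ?_
      rw [(Finset.mem_filter.1 he).2, mul_comm]
    simp only [mul_sub, Finset.sum_sub_distrib]
    rw [← h1, ← h2, ← Finset.sum_sub_distrib]
    refine Finset.sum_eq_zero fun i _ => ?_
    rw [← mul_sub, hf i]
    by_cases hi : i ∈ M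
    · rw [hu i hi, zero_mul]
    · rw [hg i hi, mul_zero]
  have hsub : boundary E c ⊆ E := Finset.filter_subset _ _
  rw [← Finset.sum_sdiff hsub] at key
  have hb : ∑ e ∈ boundary E c, f e * (u e.1 - u e.2) = κ * tvOn W (boundary E c) u := by
    unfold tvOn
    rw [Finset.mul_sum]
    refine Finset.sum_congr rfl fun e he => ?_
    rw [hbd e he, ← (hσ e he).2]
    ring
  have ho : -∑ e ∈ E \ boundary E c, f e * (u e.1 - u e.2) ≤ tvOn W (E \ boundary E c) u := by
    unfold tvOn
    rw [← Finset.sum_neg_distrib]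
    refine Finset.sum_le_sum fun e he => ?_
    calc -(f e * (u e.1 - u e.2)) ≤ |f e * (u e.1 - u e.2)| := neg_le_abs _
      _ = |f e| * |u e.1 - u e.2| := abs_mul _ _
      _ ≤ W e * |u e.1 - u e.2| := mul_le_mul_of_nonneg_right (hoff e he) (abs_nonneg _)
  linarith
end

section
/- Let x and x̂ be graph signals with ‖x̂‖_TV ≤ ‖x‖_TV, set v = x̂ − x, and suppose that for some edge subset S⊆E the signal v satisfies ‖v‖_{E∖S} ≥ 2‖v‖_S. Then ‖v‖_{E∖S} ≤ 4‖x‖_{E∖S}, and moreover ‖v‖_TV ≤ (3/2)‖v‖_{E∖S} ≤ 6‖x‖_{E∖S}. -/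
open Finset

variable {V : Type*} [DecidableEq V] {ι : Type*} [DecidableEq ι]

/-- If `‖xhat‖_TV ≤ ‖x‖_TV`, `v = xhat − x`, and `‖v‖_{E∖S} ≥ 2‖v‖_S`, then
`‖v‖_{E∖S} ≤ 4‖x‖_{E∖S}` and `‖v‖_TV ≤ (3/2)‖v‖_{E∖S} ≤ 6‖x‖_{E∖S}`. -/
theorem tv_error_bound_from_nsp
    (E : Finset (V × V)) (W : V × V → ℝ) (hW : ∀ e ∈ E, 0 < W e)
    (S : Finset (V × V)) (hS : S ⊆ E)
    (x xhat : V → ℝ) (h : tvOn W E xhat ≤ tvOn W E x)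
    (hv : 2 * tvOn W S (fun i => xhat i - x i) ≤ tvOn W (E \ S) (fun i => xhat i - x i)) :
    tvOn W (E \ S) (fun i => xhat i - x i) ≤ 4 * tvOn W (E \ S) x ∧
    tvOn W E (fun i => xhat i - x i) ≤ (3 / 2) * tvOn W (E \ S) (fun i => xhat i - x i) ∧
    tvOn W E (fun i => xhat i - x i) ≤ 6 * tvOn W (E \ S) x := by
  have hsplit : ∀ u : V → ℝ, tvOn W E u = tvOn W (E \ S) u + tvOn W S u := fun u =>
    (Finset.sum_sdiff hS).symm
  have h1 : tvOn W S x ≤ tvOn W S xhat + tvOn W S (fun i => xhat i - x i) := by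
    unfold tvOn
    rw [← Finset.sum_add_distrib]
    refine Finset.sum_le_sum fun e he => ?_
    rw [← mul_add]
    refine mul_le_mul_of_nonneg_left ?_ (hW e (hS he)).le
    have := abs_sub (xhat e.1 - xhat e.2) ((xhat e.1 - x e.1) - (xhat e.2 - x e.2))
    rwa [show xhat e.1 - xhat e.2 - ((xhat e.1 - x e.1) - (xhat e.2 - x e.2)) =
      x e.1 - x e.2 by ring] at this
  have h2 : tvOn W (E \ S) (fun i => xhat i - x i) ≤
      tvOn W (E \ S) xhat + tvOn W (E \ S) x := by
    unfold tvOn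
    rw [← Finset.sum_add_distrib]
    refine Finset.sum_le_sum fun e he => ?_
    rw [← mul_add]
    refine mul_le_mul_of_nonneg_left ?_ (hW e (Finset.mem_sdiff.mp he).1).le
    have := abs_sub (xhat e.1 - xhat e.2) (x e.1 - x e.2)
    rwa [show xhat e.1 - xhat e.2 - (x e.1 - x e.2) =
      (xhat e.1 - x e.1) - (xhat e.2 - x e.2) by ring] at this
  have e1 := hsplit x
  have e2 := hsplit xhat
  have e3 := hsplit (fun i => xhat i - x i)
  refine ⟨?_, ?_, ?_⟩ <;> linarith
end

section
/- Consider the chain graph G_chain on an even number N≥4 of nodes {1,…,N} with edges {i,i+1} for i=1,…,N−1, where every edge has weight 1 except the edge {N/2, N/2+1}, which has weight 1/δ for some 0<δ≤1. Let x_c be the clustered signal with x_c[i]=1 for i≤N/2 and x_c[i]=2 for i>N/2, and let x' be the linear interpolant x'[i] = (1 − (i−1)/(N−1))·x_c[1] + ((i−1)/(N−1))·x_c[N]. Then x' agrees with x_c at the sampled nodes 1 and N, and ‖x'‖_TV ≤ ‖x_c‖_TV; in particular, x_c is not the unique minimizer of the total variation among signals agreeing with x_c on the sampling set {1,N}. 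-/
open Finset

variable {V : Type*} [DecidableEq V] {ι : Type*} [DecidableEq ι]

/-- Edges of the chain graph on nodes `1,…,N`: the edge `{i, i+1}` is oriented with head
`i+1` and tail `i`, for `i = 1,…,N−1`. -/
def chainE (N : ℕ) : Finset (ℕ × ℕ) :=
  (Finset.Icc 1 (N - 1)).image (fun i => (i + 1, i))

/-- Weights of the chain graph: every edge has weight `1` except the boundary edge
`{N/2, N/2+1}`, which has weight `1/δ`. -/
noncomputable def chainW (N : ℕ) (δ : ℝ) : ℕ × ℕ → ℝ :=
  fun e => if e = (N / 2 + 1, N / 2) then 1 / δ else 1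

/-- The clustered signal `x_c` on the chain graph: `x_c[i] = 1` for `i ≤ N/2`, else `2`. -/
noncomputable def chainXc (N : ℕ) : ℕ → ℝ := fun i => if i ≤ N / 2 then 1 else 2

/-- The linear interpolant `x'[i] = (1 − (i−1)/(N−1)) x_c[1] + ((i−1)/(N−1)) x_c[N]`. -/
noncomputable def chainXlin (N : ℕ) : ℕ → ℝ :=
  fun i => (1 - ((i : ℝ) - 1) / ((N : ℝ) - 1)) * chainXc N 1
    + (((i : ℝ) - 1) / ((N : ℝ) - 1)) * chainXc N N

/-- For the chain graph on an even number `N ≥ 4` of nodes with boundary-edge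
weight `1/δ`, `0 < δ ≤ 1`, the linear interpolant `x'` agrees with the clustered signal `x_c`
at the sampled nodes `1` and `N` and has `‖x'‖_TV ≤ ‖x_c‖_TV`; in particular `x_c` is not the
unique minimizer of the total variation among signals agreeing with `x_c` on `{1, N}`. -/
theorem chain_no_unique_recovery
    (N : ℕ) (hN : 4 ≤ N) (hEven : Even N) (δ : ℝ) (hδ0 : 0 < δ) (hδ1 : δ ≤ 1) :
    (chainXlin N 1 = chainXc N 1 ∧ chainXlin N N = chainXc N N) ∧
    tvOn (chainW N δ) (chainE N) (chainXlin N) ≤ tvOn (chainW N δ) (chainE N) (chainXc N) ∧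
    ¬ (∀ y : ℕ → ℝ, (∀ i ∈ ({1, N} : Finset ℕ), y i = chainXc N i) → y ≠ chainXc N →
        tvOn (chainW N δ) (chainE N) (chainXc N) < tvOn (chainW N δ) (chainE N) y) := by
  have hNr : (4 : ℝ) ≤ N := by exact_mod_cast hN
  have hN1 : (0 : ℝ) < (N : ℝ) - 1 := by linarith
  have hx1 : chainXc N 1 = 1 := by
    unfold chainXc
    rw [if_pos (by omega)]
  have hxN : chainXc N N = 2 := by
    unfold chainXc
    rw [if_neg (by omega)]
  have hlin : ∀ i : ℕ, chainXlin N i = 1 + ((i : ℝ) - 1) / ((N : ℝ) - 1) := by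
    intro i
    unfold chainXlin
    rw [hx1, hxN]
    ring
  have hagree : chainXlin N 1 = chainXc N 1 ∧ chainXlin N N = chainXc N N := by
    constructor
    · rw [hlin, hx1]
      simp
    · rw [hlin, hxN, div_self hN1.ne']
      norm_num
  have hδ : (1 : ℝ) ≤ 1 / δ := by
    rw [le_div_iff₀ hδ0]
    linarith
  have hW0 : ∀ e, 0 ≤ chainW N δ e := by
    intro e
    unfold chainW
    split_ifs <;> linarith
  have hW1 : ∀ e, chainW N δ e ≤ 1 / δ := by
    intro e
    unfold chainW
    split_ifs <;> linarith
  have hupper : tvOn (chainW N δ) (chainE N) (chainXlin N) ≤ 1 / δ := by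
    have hterm : ∀ e ∈ chainE N, chainW N δ e * |chainXlin N e.1 - chainXlin N e.2|
        ≤ 1 / δ * (1 / ((N : ℝ) - 1)) := by
      intro e he
      obtain ⟨i, -, rfl⟩ := Finset.mem_image.mp he
      have hd : chainXlin N (i + 1) - chainXlin N i = 1 / ((N : ℝ) - 1) := by
        rw [hlin, hlin]
        push_cast
        ring
      simp only [hd]
      rw [abs_of_pos (by positivity)]
      exact mul_le_mul_of_nonneg_right (hW1 _) (by positivity)
    have hcard : (#(chainE N) : ℝ) ≤ (N : ℝ) - 1 := by
      have h : #(chainE N) ≤ N - 1 := by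
        unfold chainE
        exact Finset.card_image_le.trans (by simp)
      have h2 : #(chainE N) + 1 ≤ N := by omega
      have h3 : (#(chainE N) : ℝ) + 1 ≤ N := by exact_mod_cast h2
      linarith
    calc tvOn (chainW N δ) (chainE N) (chainXlin N)
        ≤ #(chainE N) • (1 / δ * (1 / ((N : ℝ) - 1))) :=
          Finset.sum_le_card_nsmul _ _ _ hterm
      _ = (#(chainE N) : ℝ) * (1 / δ * (1 / ((N : ℝ) - 1))) := nsmul_eq_mul _ _
      _ ≤ ((N : ℝ) - 1) * (1 / δ * (1 / ((N : ℝ) - 1))) :=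
          mul_le_mul_of_nonneg_right hcard (by positivity)
      _ = 1 / δ := by field_simp
  have hlower : 1 / δ ≤ tvOn (chainW N δ) (chainE N) (chainXc N) := by
    have hmem : (N / 2 + 1, N / 2) ∈ chainE N := by
      unfold chainE
      exact Finset.mem_image.mpr ⟨N / 2, Finset.mem_Icc.mpr (by omega), rfl⟩
    have hs := Finset.single_le_sum
      (f := fun e : ℕ × ℕ => chainW N δ e * |chainXc N e.1 - chainXc N e.2|)
      (fun e _ => mul_nonneg (hW0 e) (abs_nonneg _)) hmem
    have hval : chainW N δ (N / 2 + 1, N / 2) * |chainXc N (N / 2 + 1) - chainXc N (N / 2)|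
        = 1 / δ := by
      unfold chainW chainXc
      rw [if_pos rfl, if_neg (by omega), if_pos le_rfl]
      norm_num
    unfold tvOn
    exact hval.symm.le.trans hs
  refine ⟨hagree, hupper.trans hlower, fun H => ?_⟩
  refine absurd (H (chainXlin N) ?_ ?_) (not_lt.mpr (hupper.trans hlower))
  · intro i hi
    rcases Finset.mem_insert.mp hi with rfl | hi
    · exact hagree.1
    · rw [Finset.mem_singleton.mp hi]
      exact hagree.2
  · intro h
    have h2 := congrFun h 2
    rw [hlin] at h2
    unfold chainXc at h2
    rw [if_pos (by omega)] at h2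
    have : (0 : ℝ) < (((2 : ℕ) : ℝ) - 1) / ((N : ℝ) - 1) := by
      apply div_pos _ hN1
      norm_num
    linarith
end
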